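/- Consider the Metropolis–Hastings algorithm with target π_d (dπ_d/dπ̃_d = exp(−φ_d), π̃_d = N(A^{-1}b, A^{-1})) and stochastic AR(1) proposal y = Gx + g + ν. Suppose |φ_d(x)| ≤ M for all x ∈ ℝ^d and let q ∈ ℝ^d. Let E_{π_d}[(qᵀ(x'−x))²] and E_{π̃_d}[(qᵀ(x'−x))²] denote the expected squared jump size in direction q of the MH chains with targets π_d and π̃_d respectively, each in equilibrium. Then e^{-3M} E_{π̃_d}[(qᵀ(x'−x))²] ≤ E_{π_d}[(qᵀ(x'−x))²] ≤ e^{3M} E_{π̃_d}[(qᵀ(x'−x))²]. -/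

import Mathlib

noncomputable section

open MeasureTheory Matrix Filter Topology

namespace AR1

/-- Density of the Gaussian distribution on `ℝ^d` with mean `m` and *precision* matrix `P`
(covariance `P⁻¹`). -/
def gaussDensity {d : ℕ} (m : Fin d → ℝ) (P : Matrix (Fin d) (Fin d) ℝ)
    (x : Fin d → ℝ) : ℝ :=
  Real.sqrt (P.det / (2 * Real.pi) ^ d) *
    Real.exp (-(1 / 2) * ((x - m) ⬝ᵥ (P *ᵥ (x - m))))

/-- Gaussian measure on `ℝ^d` with mean `m` and precision matrix `P`. -/
def gaussMeasure {d : ℕ} (m : Fin d → ℝ) (P : Matrix (Fin d) (Fin d) ℝ) :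
    Measure (Fin d → ℝ) :=
  volume.withDensity fun x => ENNReal.ofReal (gaussDensity m P x)

/-- Transition density of the stochastic AR(1) proposal `y = G x + g + ν`, `ν ~ N(0, S)`. -/
def propDensity {d : ℕ} (G : Matrix (Fin d) (Fin d) ℝ) (g : Fin d → ℝ)
    (S : Matrix (Fin d) (Fin d) ℝ) (x y : Fin d → ℝ) : ℝ :=
  gaussDensity (G *ᵥ x + g) S⁻¹ y

/-- Metropolis–Hastings acceptance probability for target density `tden` and proposal
transition density `qden`. -/
def accept {d : ℕ} (tden : (Fin d → ℝ) → ℝ) (qden : (Fin d → ℝ) → (Fin d → ℝ) → ℝ)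
    (x y : Fin d → ℝ) : ℝ :=
  min 1 (tden y * qden y x / (tden x * qden x y))

/-- Joint law of (current state, proposal) when the chain is in equilibrium. -/
def jointMeasure {d : ℕ} (tden : (Fin d → ℝ) → ℝ)
    (qden : (Fin d → ℝ) → (Fin d → ℝ) → ℝ) :
    Measure ((Fin d → ℝ) × (Fin d → ℝ)) :=
  volume.withDensity fun pr => ENNReal.ofReal (tden pr.1 * qden pr.1 pr.2)

/-- Expected Metropolis–Hastings acceptance probability in equilibrium. -/
def expAccept {d : ℕ} (tden : (Fin d → ℝ) → ℝ)
    (qden : (Fin d → ℝ) → (Fin d → ℝ) → ℝ) : ℝ :=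
  ∫ pr, accept tden qden pr.1 pr.2 ∂(jointMeasure tden qden)

/-- Expected squared jump size in direction `v`, in equilibrium:
`E[(vᵀ(x' - x))²]` where `x'` is the next state of the Metropolis–Hastings chain. -/
def expSqJump {d : ℕ} (tden : (Fin d → ℝ) → ℝ)
    (qden : (Fin d → ℝ) → (Fin d → ℝ) → ℝ) (v : Fin d → ℝ) : ℝ :=
  ∫ pr, (v ⬝ᵥ (pr.2 - pr.1)) ^ 2 * accept tden qden pr.1 pr.2 ∂(jointMeasure tden qden)

/-- `Z = log (π(y) q(y,x) / (π(x) q(x,y)))`. -/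
def logRatio {d : ℕ} (tden : (Fin d → ℝ) → ℝ)
    (qden : (Fin d → ℝ) → (Fin d → ℝ) → ℝ)
    (pr : (Fin d → ℝ) × (Fin d → ℝ)) : ℝ :=
  Real.log (tden pr.2 * qden pr.2 pr.1 / (tden pr.1 * qden pr.1 pr.2))

/-- Standard normal cumulative distribution function `Φ`. -/
def stdNormalCDF (z : ℝ) : ℝ :=
  (ProbabilityTheory.gaussianReal 0 1 (Set.Iic z)).toReal

/-- `Φ(μ/σ) + e^{μ + σ²/2} Φ(-σ - μ/σ)`. -/
def acceptLimit (μ σ : ℝ) : ℝ :=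
  stdNormalCDF (μ / σ) + Real.exp (μ + σ ^ 2 / 2) * stdNormalCDF (-σ - μ / σ)

/-- Normalized density of the target `π_d` with `dπ_d/dπ̃_d = exp(-φ)`,
`π̃_d = N(m, A⁻¹)` (precision `A`). -/
def ngDensity {d : ℕ} (φ : (Fin d → ℝ) → ℝ) (m : Fin d → ℝ)
    (A : Matrix (Fin d) (Fin d) ℝ) (x : Fin d → ℝ) : ℝ :=
  Real.exp (-(φ x)) * gaussDensity m A x /
    ∫ y, Real.exp (-(φ y)) * gaussDensity m A y

/-- Real power `A^s` of a symmetric positive definite matrix `A = Q diag(lam2) Qᵀ`. -/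
def apow {d : ℕ} (Q : Matrix (Fin d) (Fin d) ℝ) (lam2 : Fin d → ℝ) (s : ℝ) :
    Matrix (Fin d) (Fin d) ℝ :=
  Q * Matrix.diagonal (fun i => lam2 i ^ s) * Qᵀ

/-- The norm `|x|_s = |A^s x|` associated with `A = Q diag(lam2) Qᵀ`. -/
def anorm {d : ℕ} (Q : Matrix (Fin d) (Fin d) ℝ) (lam2 : Fin d → ℝ) (s : ℝ)
    (v : Fin d → ℝ) : ℝ :=
  Real.sqrt ((apow Q lam2 s *ᵥ v) ⬝ᵥ (apow Q lam2 s *ᵥ v))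

end AR1

namespace AR1

theorem integral_exp_neg_half_dotProduct (d : ℕ) :
    ∫ x : Fin d → ℝ, Real.exp (-(1 / 2) * (x ⬝ᵥ x)) = Real.sqrt ((2 * Real.pi) ^ d) := by
  have h (x : Fin d → ℝ) :
      Real.exp (-(1 / 2) * (x ⬝ᵥ x)) = ∏ i, Real.exp (-(1 / 2) * x i ^ 2) := by
    rw [← Real.exp_sum, ← Finset.mul_sum]
    simp only [dotProduct, sq]
  simp_rw [h]
  rw [integral_fintype_prod_volume_eq_pow (fun t : ℝ => Real.exp (-(1 / 2) * t ^ 2)),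
    integral_gaussian, Fintype.card_fin, eq_comm, Real.sqrt_eq_iff_mul_self_eq (by positivity)
      (by positivity), ← mul_pow, Real.mul_self_sqrt (by positivity)]
  congr 1
  ring

open scoped MatrixOrder Matrix.Norms.L2Operator in
theorem integral_gaussDensity {d : ℕ} (m : Fin d → ℝ) {P : Matrix (Fin d) (Fin d) ℝ}
    (hP : P.PosDef) : ∫ x, gaussDensity m P x = 1 := by
  obtain ⟨B, hB⟩ := CStarAlgebra.nonneg_iff_eq_star_mul_self.mp hP.posSemidef.nonneg
  rw [star_eq_conjTranspose, conjTranspose_eq_transpose_of_trivial] at hB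
  have hdet : P.det = B.det ^ 2 := by rw [hB, det_mul, det_transpose, sq]
  have hB0 : B.det ≠ 0 := fun h => hP.det_pos.ne' (by rw [hdet, h]; simp)
  have hquad (x : Fin d → ℝ) : x ⬝ᵥ (P *ᵥ x) = (B *ᵥ x) ⬝ᵥ (B *ᵥ x) := by
    rw [hB, ← mulVec_mulVec, dotProduct_mulVec, vecMul_transpose]
  have hmap : ∫ x, Real.exp (-(1 / 2) * ((B *ᵥ x) ⬝ᵥ (B *ᵥ x))) =
      |B.det|⁻¹ * Real.sqrt ((2 * Real.pi) ^ d) := by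
    have hcont : Continuous fun x : Fin d → ℝ => Real.exp (-(1 / 2) * (x ⬝ᵥ x)) := by
      simp only [dotProduct]
      fun_prop
    have hmeas : Measurable (Matrix.toLin' B) :=
      (LinearMap.continuous_of_finiteDimensional _).measurable
    have h := integral_map (μ := volume) hmeas.aemeasurable
      hcont.aestronglyMeasurable
    rw [Real.map_matrix_volume_pi_eq_smul_volume_pi hB0, integral_smul_measure,
      integral_exp_neg_half_dotProduct] at h
    simp only [toLin'_apply] at h
    rw [← h, ENNReal.toReal_ofReal (abs_nonneg _), abs_inv, smul_eq_mul]
  simp only [gaussDensity]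
  rw [integral_const_mul,
    integral_sub_right_eq_self (fun x => Real.exp (-(1 / 2) * (x ⬝ᵥ (P *ᵥ x)))) m]
  simp_rw [hquad]
  rw [hmap, hdet, Real.sqrt_div (sq_nonneg _), Real.sqrt_sq_eq_abs]
  have : Real.sqrt ((2 * Real.pi) ^ d) ≠ 0 := by positivity
  have : |B.det| ≠ 0 := abs_ne_zero.mpr hB0
  field_simp

theorem gaussDensity_pos {d : ℕ} (m : Fin d → ℝ) {P : Matrix (Fin d) (Fin d) ℝ}
    (hP : P.PosDef) (x : Fin d → ℝ) : 0 < gaussDensity m P x := by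
  have := hP.det_pos
  unfold gaussDensity
  positivity

theorem continuous_gaussDensity {d : ℕ} (P : Matrix (Fin d) (Fin d) ℝ) :
    Continuous fun pr : (Fin d → ℝ) × (Fin d → ℝ) => gaussDensity pr.1 P pr.2 := by
  unfold gaussDensity
  fun_prop

theorem continuous_propDensity {d : ℕ} (G : Matrix (Fin d) (Fin d) ℝ) (g : Fin d → ℝ)
    (S : Matrix (Fin d) (Fin d) ℝ) :
    Continuous fun pr : (Fin d → ℝ) × (Fin d → ℝ) => propDensity G g S pr.1 pr.2 :=
  (continuous_gaussDensity S⁻¹).comp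
    (f := fun pr : (Fin d → ℝ) × (Fin d → ℝ) => (G *ᵥ pr.1 + g, pr.2)) (by fun_prop)

/-- The product of the equilibrium density of (state, proposal) and the acceptance probability
is symmetric in the two arguments. -/
theorem expSqJump_eq_integral_min {d : ℕ} {tden : (Fin d → ℝ) → ℝ}
    {qden : (Fin d → ℝ) → (Fin d → ℝ) → ℝ} (ht : ∀ x, 0 < tden x) (hq : ∀ x y, 0 < qden x y)
    (htm : Measurable tden) (hqm : Measurable fun pr : (Fin d → ℝ) × (Fin d → ℝ) =>
      qden pr.1 pr.2) (v : Fin d → ℝ) :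
    expSqJump tden qden v = ∫ pr : (Fin d → ℝ) × (Fin d → ℝ), (v ⬝ᵥ (pr.2 - pr.1)) ^ 2 *
      min (tden pr.1 * qden pr.1 pr.2) (tden pr.2 * qden pr.2 pr.1) := by
  unfold expSqJump jointMeasure
  have hm : Measurable fun pr : (Fin d → ℝ) × (Fin d → ℝ) =>
      ENNReal.ofReal (tden pr.1 * qden pr.1 pr.2) :=
    ((htm.comp measurable_fst).mul hqm).ennreal_ofReal
  rw [integral_withDensity_eq_integral_toReal_smul hm (by simp)]
  refine integral_congr_ae (.of_forall fun pr => ?_)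
  have hpos : 0 < tden pr.1 * qden pr.1 pr.2 := mul_pos (ht _) (hq _ _)
  simp only [accept, smul_eq_mul]
  rw [ENNReal.toReal_ofReal hpos.le, mul_left_comm, mul_min_of_nonneg _ _ hpos.le, mul_one,
    mul_div_cancel₀ _ hpos.ne']

/-- No integrability is needed: comparable functions are integrable simultaneously. -/
theorem integral_le_const_mul_integral {α : Type*} [MeasurableSpace α] {μ : Measure α}
    {f h : α → ℝ} {c c' : ℝ} (hhm : AEStronglyMeasurable h μ)
    (hf : ∀ x, 0 ≤ f x) (hh : ∀ x, 0 ≤ h x) (hfh : ∀ x, f x ≤ c * h x)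
    (hhf : ∀ x, h x ≤ c' * f x) : ∫ x, f x ∂μ ≤ c * ∫ x, h x ∂μ := by
  by_cases hi : Integrable h μ
  · rw [← integral_const_mul]
    exact integral_mono_of_nonneg (.of_forall hf) (hi.const_mul c) (.of_forall hfh)
  · have hi' : ¬ Integrable f μ := fun hfi => hi <|
      (hfi.const_mul c').mono' hhm (.of_forall fun x => by
        rw [Real.norm_of_nonneg (hh x)]; exact hhf x)
    rw [integral_undef hi, integral_undef hi', mul_zero]

/-- Bounding the target densities by each other bounds the expected squared jump sizes. -/
theorem expSqJump_le_const_mul {d : ℕ} {s t : (Fin d → ℝ) → ℝ}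
    {qden : (Fin d → ℝ) → (Fin d → ℝ) → ℝ} {c c' : ℝ} (hc : 0 ≤ c) (hc' : 0 ≤ c')
    (hs : ∀ x, 0 < s x) (ht : ∀ x, 0 < t x)
    (hq : ∀ x y, 0 < qden x y) (hsm : Measurable s) (htm : Measurable t)
    (hqm : Measurable fun pr : (Fin d → ℝ) × (Fin d → ℝ) => qden pr.1 pr.2)
    (hst : ∀ x, s x ≤ c * t x) (hts : ∀ x, t x ≤ c' * s x) (v : Fin d → ℝ) :
    expSqJump s qden v ≤ c * expSqJump t qden v := by
  have hqm' : Measurable fun pr : (Fin d → ℝ) × (Fin d → ℝ) => qden pr.2 pr.1 :=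
    hqm.comp measurable_swap
  have hmeas {u : (Fin d → ℝ) → ℝ} (hu : Measurable u) :
      AEStronglyMeasurable (fun pr : (Fin d → ℝ) × (Fin d → ℝ) => (v ⬝ᵥ (pr.2 - pr.1)) ^ 2 *
        min (u pr.1 * qden pr.1 pr.2) (u pr.2 * qden pr.2 pr.1)) volume := by
    have hv : Continuous fun pr : (Fin d → ℝ) × (Fin d → ℝ) => (v ⬝ᵥ (pr.2 - pr.1)) ^ 2 := by
      fun_prop
    exact (hv.measurable.mul (((hu.comp measurable_fst).mul hqm).min
      ((hu.comp measurable_snd).mul hqm'))).aestronglyMeasurable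
  have hnonneg {u : (Fin d → ℝ) → ℝ} (hu : ∀ x, 0 < u x) (pr : (Fin d → ℝ) × (Fin d → ℝ)) :
      0 ≤ (v ⬝ᵥ (pr.2 - pr.1)) ^ 2 *
        min (u pr.1 * qden pr.1 pr.2) (u pr.2 * qden pr.2 pr.1) :=
    mul_nonneg (sq_nonneg _)
      (le_min (mul_pos (hu _) (hq _ _)).le (mul_pos (hu _) (hq _ _)).le)
  have hle {u w : (Fin d → ℝ) → ℝ} {k : ℝ} (hk : 0 ≤ k) (huw : ∀ x, u x ≤ k * w x)
      (pr : (Fin d → ℝ) × (Fin d → ℝ)) :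
      (v ⬝ᵥ (pr.2 - pr.1)) ^ 2 *
        min (u pr.1 * qden pr.1 pr.2) (u pr.2 * qden pr.2 pr.1) ≤
      k * ((v ⬝ᵥ (pr.2 - pr.1)) ^ 2 *
        min (w pr.1 * qden pr.1 pr.2) (w pr.2 * qden pr.2 pr.1)) := by
    rw [mul_left_comm, mul_min_of_nonneg _ _ hk, ← mul_assoc k, ← mul_assoc k]
    exact mul_le_mul_of_nonneg_left (min_le_min
      (mul_le_mul_of_nonneg_right (huw _) (hq _ _).le)
      (mul_le_mul_of_nonneg_right (huw _) (hq _ _).le)) (sq_nonneg _)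
  rw [expSqJump_eq_integral_min hs hq hsm hqm, expSqJump_eq_integral_min ht hq htm hqm]
  exact integral_le_const_mul_integral (hmeas htm) (hnonneg hs) (hnonneg ht)
    (hle hc hst) (hle hc' hts)

/-- The normalizing constant of a bounded perturbation of a Gaussian. -/
theorem integral_exp_neg_mul_gaussDensity_mem_Icc {d : ℕ} (m : Fin d → ℝ)
    {A : Matrix (Fin d) (Fin d) ℝ} (hA : A.PosDef) {φ : (Fin d → ℝ) → ℝ} (hφm : Measurable φ)
    {M : ℝ} (hM : ∀ x, |φ x| ≤ M) :
    ∫ y, Real.exp (-(φ y)) * gaussDensity m A y ∈ Set.Icc (Real.exp (-M)) (Real.exp M) := by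
  have hgauss : Integrable (gaussDensity m A) :=
    .of_integral_ne_zero (by rw [integral_gaussDensity m hA]; exact one_ne_zero)
  have hupper (y : Fin d → ℝ) :
      Real.exp (-(φ y)) * gaussDensity m A y ≤ Real.exp M * gaussDensity m A y :=
    mul_le_mul_of_nonneg_right (Real.exp_le_exp.mpr (neg_le.mp (abs_le.mp (hM y)).1))
      (gaussDensity_pos m hA y).le
  have hlower (y : Fin d → ℝ) :
      Real.exp (-M) * gaussDensity m A y ≤ Real.exp (-(φ y)) * gaussDensity m A y :=
    mul_le_mul_of_nonneg_right (Real.exp_le_exp.mpr (neg_le_neg (abs_le.mp (hM y)).2))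
      (gaussDensity_pos m hA y).le
  have hnonneg (y : Fin d → ℝ) : 0 ≤ Real.exp (-(φ y)) * gaussDensity m A y :=
    (mul_pos (Real.exp_pos _) (gaussDensity_pos m hA y)).le
  have hpert : Integrable fun y => Real.exp (-(φ y)) * gaussDensity m A y :=
    (hgauss.const_mul (Real.exp M)).mono'
      (hφm.neg.exp.aestronglyMeasurable.mul hgauss.aestronglyMeasurable)
      (.of_forall fun y => by rw [Real.norm_of_nonneg (hnonneg y)]; exact hupper y)
  have h₁ := integral_mono (hgauss.const_mul (Real.exp (-M))) hpert hlower
  have h₂ := integral_mono hpert (hgauss.const_mul (Real.exp M)) hupper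
  rw [integral_const_mul, integral_gaussDensity m hA, mul_one] at h₁ h₂
  exact ⟨h₁, h₂⟩

/-- With `|φ_d| ≤ M` and `q ∈ ℝ^d`,
`e^{−3M} E_{π̃}[(qᵀ(x'−x))²] ≤ E_{π}[(qᵀ(x'−x))²] ≤ e^{3M} E_{π̃}[(qᵀ(x'−x))²]`
for the MH chains with targets `π_d` and `π̃_d` in equilibrium. -/
theorem stmt_13 {d : ℕ} (A G S : Matrix (Fin d) (Fin d) ℝ) (b g : Fin d → ℝ)
    (hA : A.PosDef) (hS : S.PosDef)
    (φ : (Fin d → ℝ) → ℝ) (hφm : Measurable φ)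
    (M : ℝ) (hM : ∀ x, |φ x| ≤ M)
    (qdir : Fin d → ℝ) :
    Real.exp (-(3 * M)) *
        expSqJump (gaussDensity (A⁻¹ *ᵥ b) A) (propDensity G g S) qdir ≤
      expSqJump (ngDensity φ (A⁻¹ *ᵥ b) A) (propDensity G g S) qdir ∧
    expSqJump (ngDensity φ (A⁻¹ *ᵥ b) A) (propDensity G g S) qdir ≤
      Real.exp (3 * M) *
        expSqJump (gaussDensity (A⁻¹ *ᵥ b) A) (propDensity G g S) qdir := by
  have hM0 : 0 ≤ M := (abs_nonneg _).trans (hM 0)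
  set m := A⁻¹ *ᵥ b
  obtain ⟨hZ₁, hZ₂⟩ := integral_exp_neg_mul_gaussDensity_mem_Icc m hA hφm hM
  have hZ := (Real.exp_pos (-M)).trans_le hZ₁
  have hpos := gaussDensity_pos m hA
  have hm : Measurable (gaussDensity m A) :=
    ((continuous_gaussDensity A).comp (Continuous.prodMk_right m)).measurable
  have hngpos (x) : 0 < ngDensity φ m A x :=
    div_pos (mul_pos (Real.exp_pos _) (hpos x)) hZ
  have hngm : Measurable (ngDensity φ m A) := (hφm.neg.exp.mul hm).div_const _
  have hupper (x) : ngDensity φ m A x ≤ Real.exp (3 * M) * gaussDensity m A x := by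
    rw [ngDensity, div_le_iff₀ hZ, mul_right_comm]
    refine mul_le_mul_of_nonneg_right ?_ (hpos x).le
    calc Real.exp (-(φ x)) ≤ Real.exp (3 * M) * Real.exp (-M) := by
          rw [← Real.exp_add, Real.exp_le_exp]
          linarith [(abs_le.mp (hM x)).1]
      _ ≤ _ := mul_le_mul_of_nonneg_left hZ₁ (Real.exp_pos _).le
  have hlower (x) : gaussDensity m A x ≤ Real.exp (3 * M) * ngDensity φ m A x := by
    rw [ngDensity, mul_div_assoc', le_div_iff₀ hZ, ← mul_assoc, mul_comm]
    refine mul_le_mul_of_nonneg_right (hZ₂.trans ?_) (hpos x).le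
    rw [← Real.exp_add, Real.exp_le_exp]
    linarith [(abs_le.mp (hM x)).2]
  have hq (x y) : 0 < propDensity G g S x y := gaussDensity_pos _ hS.inv y
  have hqm := (continuous_propDensity G g S).measurable
  have hc := (Real.exp_pos (3 * M)).le
  refine ⟨?_, expSqJump_le_const_mul hc hc hngpos hpos hq hngm hm hqm hupper hlower qdir⟩
  rw [Real.exp_neg, inv_mul_le_iff₀ (Real.exp_pos _)]
  exact expSqJump_le_const_mul hc hc hpos hngpos hq hm hngm hqm hlower hupper qdir

end AR1
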